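/- Fix r ∈ (0, ∞). Let p̂_{T,CL} be the univariate threshold predictive density estimator that equals the Bayes predictive density p̂_π(·|x) for the cluster prior π = π_{CL}[η, r] when |x| ≤ λ_e(η), and equals N(x, 1+r) when |x| > λ_e(η). Then limsup_{η → 0} [ sup_{π ∈ 𝔪(η)} B(π, p̂_{T,CL}) ] / ( (2r)^{-1} η λ_f(η)² ) ≤ 1. -/

import Mathlib

open MeasureTheory ProbabilityTheory Filter
open scoped ENNReal NNReal

noncomputable section

/-- Real-valued Kullback–Leibler divergence `KL(μ ‖ ν) = ∫ log (dμ/dν) dμ`. -/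
def KLdiv {E : Type*} [MeasurableSpace E] (μ ν : Measure E) : ℝ :=
  ∫ x, Real.log ((μ.rnDeriv ν x).toReal) ∂μ

/-- Product Gaussian measure `⊗_{i<n} N(θ i, v)` on `ℝⁿ`. -/
def gaussPi {n : ℕ} (θ : Fin n → ℝ) (v : ℝ≥0) : Measure (Fin n → ℝ) :=
  Measure.pi fun i => gaussianReal (θ i) v

/-- KL prediction risk in the n-dimensional Gaussian sequence model:
past observation `X ~ N_n(θ, I)`, future `Y ~ N_n(θ, r I)`. -/
def risk {n : ℕ} (r : ℝ≥0) (θ : Fin n → ℝ)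
    (phat : (Fin n → ℝ) → Measure (Fin n → ℝ)) : ℝ :=
  ∫ x, KLdiv (gaussPi θ r) (phat x) ∂(gaussPi θ 1)

/-- Univariate KL prediction risk: past `X ~ N(θ,1)`, future `Y ~ N(θ,r)`. -/
def risk1 (r : ℝ≥0) (θ : ℝ) (phat : ℝ → Measure ℝ) : ℝ :=
  ∫ x, KLdiv (gaussianReal θ r) (phat x) ∂(gaussianReal θ 1)

/-- The ℓ₀-sparse parameter set `Θ_n[s]`. -/
def sparseSet (n s : ℕ) : Set (Fin n → ℝ) :=
  {θ | Set.ncard {i | θ i ≠ 0} ≤ s}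

/-- Minimax KL risk over all (Markov kernel) predictive density estimators. -/
def minimaxRisk {n : ℕ} (r : ℝ≥0) (Θ : Set (Fin n → ℝ)) : ℝ :=
  ⨅ κ : {κ : Kernel (Fin n → ℝ) (Fin n → ℝ) // IsMarkovKernel κ},
    ⨆ θ : Θ, risk r θ.1 (fun x => κ.1 x)
/-- `λ_e(η) = √(2 log(η⁻¹(1−η)))`. -/
def lamE (η : ℝ) : ℝ := Real.sqrt (2 * Real.log (η⁻¹ * (1 - η)))

/-- Oracle variance `v_w = r/(1+r)`. -/
def vw (r : ℝ) : ℝ := r / (1 + r)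

/-- `λ_f(η) = √v_w · λ_e(η)`. -/
def lamF (r η : ℝ) : ℝ := Real.sqrt (vw r) * lamE η

/-- Bayes KL risk of a prior on `ℝⁿ`: infimum of integrated risk over Markov kernels. -/
def bayesRisk {n : ℕ} (r : ℝ≥0) (π : Measure (Fin n → ℝ)) : ℝ :=
  ⨅ κ : {κ : Kernel (Fin n → ℝ) (Fin n → ℝ) // IsMarkovKernel κ},
    ∫ θ, risk r θ (fun x => κ.1 x) ∂π

/-- Univariate integrated (Bayes) risk of an estimator w.r.t. a prior. -/
def intRisk1 (r : ℝ≥0) (π : Measure ℝ) (phat : ℝ → Measure ℝ) : ℝ :=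
  ∫ θ, risk1 r θ phat ∂π

/-- Univariate Bayes KL risk of a prior. -/
def bayesRisk1 (r : ℝ≥0) (π : Measure ℝ) : ℝ :=
  ⨅ κ : {κ : Kernel ℝ ℝ // IsMarkovKernel κ},
    intRisk1 r π (fun x => κ.1 x)

/-- The sparse prior class `𝔪(η)`. -/
def priorClass (η : ℝ) : Set (Measure ℝ) :=
  {π | IsProbabilityMeasure π ∧ π {θ : ℝ | θ ≠ 0} ≤ ENNReal.ofReal η}

/-- Univariate sparse minimax predictive risk `β(η, r)`. -/
def betaMinimax (r : ℝ≥0) (η : ℝ) : ℝ :=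
  ⨅ κ : {κ : Kernel ℝ ℝ // IsMarkovKernel κ},
    ⨆ π : priorClass η, intRisk1 r π.1 (fun x => κ.1 x)

/-- Two-point sparse prior `(1−η)δ₀ + ηδ_λ`. -/
def twoPointPrior (η lam : ℝ) : Measure ℝ :=
  ENNReal.ofReal (1 - η) • Measure.dirac 0 + ENNReal.ofReal η • Measure.dirac lam

/-- `a_η = √(2 log λ_f(η))`. -/
def aEta (r η : ℝ) : ℝ := Real.sqrt (2 * Real.log (lamF r η))

/-- `μ_η`: the positive root of `μ² + 2 a_η μ = λ_e(η)²`. -/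
def muEta (r η : ℝ) : ℝ := Real.sqrt (aEta r η ^ 2 + lamE η ^ 2) - aEta r η

/-- `ν_η = √v_w · μ_η`. -/
def nuEta (r η : ℝ) : ℝ := Real.sqrt (vw r) * muEta r η

/-- Support points of the cluster prior: `μ_k = (1+2r)^{k-1} ν_η` for `k ≥ 1`. -/
def clusterMu (r η : ℝ) (k : ℕ) : ℝ := (1 + 2 * r) ^ (k - 1) * nuEta r η

/-- `K = max{k : μ_k ≤ λ_e(η) + a_η}` (as the cardinality of `{1, …, K}`). -/
def clusterK (r η : ℝ) : ℕ :=
  Set.ncard {k : ℕ | 1 ≤ k ∧ clusterMu r η k ≤ lamE η + aEta r η}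

/-- The cluster prior `π_CL[η, r]`. -/
def clusterPrior (r η : ℝ) : Measure ℝ :=
  ENNReal.ofReal (1 - η) • Measure.dirac 0 +
    ENNReal.ofReal (η / (2 * clusterK r η)) •
      ∑ k ∈ Finset.Icc 1 (clusterK r η),
        (Measure.dirac (clusterMu r η k) + Measure.dirac (-(clusterMu r η k)))

/-- Bayes predictive density: the measure on `ℝ` with Lebesgue density
`y ↦ ∫ φ(y−θ; r) φ(x−θ; 1) π(dθ) / ∫ φ(x−θ; 1) π(dθ)`. -/
def bayesPredMeasure (r : ℝ≥0) (π : Measure ℝ) (x : ℝ) : Measure ℝ :=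
  MeasureTheory.volume.withDensity fun y => ENNReal.ofReal
    ((∫ θ, gaussianPDFReal θ r y * gaussianPDFReal θ 1 x ∂π) /
      (∫ θ, gaussianPDFReal θ 1 x ∂π))

/-- Univariate threshold predictive density estimator based on the cluster prior:
`p̂_π(·|x)` for `|x| ≤ λ_e(η)` and `N(x, 1+r)` above the threshold. -/
def pTCL (r : ℝ≥0) (η : ℝ) (x : ℝ) : Measure ℝ :=
  if |x| ≤ lamE η then bayesPredMeasure r (clusterPrior (r : ℝ) η) x
  else gaussianReal x (1 + r)

lemma integral_le_max_zero {α : Type*} [MeasurableSpace α] {μ : Measure α} {f g : α → ℝ}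
    (hg : Integrable g μ) (h : f ≤ᵐ[μ] g) : ∫ x, f x ∂μ ≤ max 0 (∫ x, g x ∂μ) := by
  by_cases hf : Integrable f μ
  · exact (integral_mono_ae hf hg h).trans (le_max_right _ _)
  · rw [integral_undef hf]; exact le_max_left _ _

lemma gm_id (θ : ℝ) (v : ℝ≥0) : Integrable (fun y : ℝ => y - θ) (gaussianReal θ v) :=
  ((memLp_id_gaussianReal (μ := θ) (v := v) 1).integrable (by simp)).sub (integrable_const θ)

lemma gm_id_int (θ : ℝ) (v : ℝ≥0) : ∫ y, (y - θ) ∂(gaussianReal θ v) = 0 := by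
  have h : Integrable (fun y : ℝ => y) (gaussianReal θ v) :=
    (memLp_id_gaussianReal (μ := θ) (v := v) 1).integrable (by simp)
  rw [integral_sub h (integrable_const θ)]
  simp

lemma gm_sq (θ : ℝ) (v : ℝ≥0) : Integrable (fun y : ℝ => (y - θ) ^ 2) (gaussianReal θ v) := by
  have h : MemLp (fun y : ℝ => y - θ) 2 (gaussianReal θ v) :=
    (memLp_id_gaussianReal (μ := θ) (v := v) 2).sub (memLp_const θ)
  exact h.integrable_sq

lemma gm_sq_int (θ : ℝ) (v : ℝ≥0) : ∫ y, (y - θ) ^ 2 ∂(gaussianReal θ v) = v := by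
  have h := variance_fun_id_gaussianReal (μ := θ) (v := v)
  rw [variance_eq_integral (by fun_prop)] at h
  simpa using h

/-- core bound on KL against a measure with positive Lebesgue density. -/
lemma KLdiv_le_core {r : ℝ≥0} (hr : 0 < r) (θ : ℝ) {g h : ℝ → ℝ} (hg : Measurable g)
    (hgpos : ∀ y, 0 < g y) (hh : Integrable h (gaussianReal θ r))
    (hle : ∀ y, Real.log (gaussianPDFReal θ r y / g y) ≤ h y) :
    KLdiv (gaussianReal θ r) (volume.withDensity fun y => ENNReal.ofReal (g y))
      ≤ max 0 (∫ y, h y ∂(gaussianReal θ r)) := by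
  unfold KLdiv
  apply integral_le_max_zero hh
  have h1 := Measure.rnDeriv_withDensity_right (gaussianReal θ r) volume
    (f := fun y => ENNReal.ofReal (g y)) hg.ennreal_ofReal.aemeasurable
    (ae_of_all _ fun y => by simpa using hgpos y) (ae_of_all _ fun y => by simp)
  have hac := gaussianReal_absolutelyContinuous θ hr.ne'
  filter_upwards [hac.ae_le h1, hac.ae_le (rnDeriv_gaussianReal θ r)] with y h1 h2
  rw [h1, h2, ENNReal.toReal_mul, toReal_gaussianPDF, ENNReal.toReal_inv,
    ENNReal.toReal_ofReal (hgpos y).le, mul_comm, ← div_eq_mul_inv]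
  exact hle y

lemma log_pdf_ratio {r : ℝ≥0} (hr : 0 < r) (θ m y : ℝ) :
    Real.log (gaussianPDFReal θ r y / gaussianPDFReal m r y)
      = (θ - m) / r * (y - θ) + (θ - m) ^ 2 / (2 * r) := by
  have hr' : (0 : ℝ) < r := hr
  have : (0:ℝ) < √(2 * Real.pi * r) := by positivity
  unfold gaussianPDFReal
  rw [mul_div_mul_left _ _ (by positivity), ← Real.exp_sub, Real.log_exp]
  field_simp
  ring

lemma KLdiv_bayes_le {r : ℝ≥0} (hr : 0 < r) (θ m c d dn : ℝ) {num : ℝ → ℝ}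
    (hnum : Measurable num) (hc : 0 < c) (hdn : 0 < dn) (hd : dn ≤ d)
    (hle : ∀ y, c * gaussianPDFReal m r y ≤ num y) :
    KLdiv (gaussianReal θ r) (volume.withDensity fun y => ENNReal.ofReal (num y / dn))
      ≤ max 0 (Real.log (d / c) + (θ - m) ^ 2 / (2 * r)) := by
  have hp := fun y => gaussianPDFReal_pos m r y hr.ne'
  have hp' := fun y => gaussianPDFReal_pos θ r y hr.ne'
  have hnp : ∀ y, 0 < num y := fun y => (mul_pos hc (hp y)).trans_le (hle y)
  have hint := ((gm_id θ r).const_mul ((θ - m) / r)).add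
    (integrable_const (Real.log (d / c) + (θ - m) ^ 2 / (2 * r)))
  have := KLdiv_le_core hr θ (g := fun y => num y / dn)
    (h := fun y => (θ - m) / r * (y - θ) + (Real.log (d / c) + (θ - m) ^ 2 / (2 * r)))
    (hnum.div_const _) (fun y => div_pos (hnp y) hdn) hint ?_
  · rw [integral_add ((gm_id θ r).const_mul _) (integrable_const _), integral_const_mul,
      gm_id_int] at this
    simpa using this
  · intro y
    have h1 := log_pdf_ratio hr θ m y
    have h2 : gaussianPDFReal θ r y / (num y / dn) ≤
        (gaussianPDFReal θ r y / gaussianPDFReal m r y) * (d / c) := by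
      rw [div_div_eq_mul_div, div_mul_div_comm]
      have := hp' y
      have := hp y
      have := hle y
      have := mul_pos hc (hp y)
      rw [mul_comm (gaussianPDFReal m r y) c]
      have := hdn.trans_le hd
      gcongr
    have h3 := Real.log_le_log (div_pos (hp' y) (div_pos (hnp y) hdn)) h2
    rw [Real.log_mul (div_pos (hp' y) (hp y)).ne' (div_pos (hdn.trans_le hd) hc).ne', h1] at h3
    linarith

/-- constant for the Gaussian part -/
def Cr (r : ℝ≥0) : ℝ := |Real.log (√(2 * Real.pi * (1 + r)) / √(2 * Real.pi * r))| + r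

lemma Cr_nonneg (r : ℝ≥0) : 0 ≤ Cr r := by unfold Cr; positivity

lemma KLdiv_gauss_le {r : ℝ≥0} (hr : 0 < r) (θ x : ℝ) :
    KLdiv (gaussianReal θ r) (gaussianReal x (1 + r)) ≤ Cr r + (x - θ) ^ 2 := by
  have h1r : (1 + r : ℝ≥0) ≠ 0 := by positivity
  have hr' : (0 : ℝ) < r := hr
  rw [gaussianReal_of_var_ne_zero x h1r]
  have hint := ((gm_sq θ r).add (integrable_const
    (|Real.log (√(2 * Real.pi * (1 + r)) / √(2 * Real.pi * r))| + (x - θ) ^ 2)))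
  have := KLdiv_le_core hr θ (g := gaussianPDFReal x (1 + r))
    (h := fun y => (y - θ) ^ 2 +
      (|Real.log (√(2 * Real.pi * (1 + r)) / √(2 * Real.pi * r))| + (x - θ) ^ 2))
    (measurable_gaussianPDFReal _ _) (fun y => gaussianPDFReal_pos _ _ _ h1r) hint ?_
  · rw [integral_add (gm_sq θ r) (integrable_const _), gm_sq_int] at this
    simp only [integral_const, probReal_univ, one_smul] at this
    refine this.trans (max_le ?_ ?_)
    · have := Cr_nonneg r
      positivity
    · unfold Cr; linarith
  · intro y
    unfold gaussianPDFReal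
    push_cast
    have e1 : (0:ℝ) < √(2 * Real.pi * r) := by positivity
    have e2 : (0:ℝ) < √(2 * Real.pi * (1 + r)) := by positivity
    have : (√(2 * Real.pi * r))⁻¹ * Real.exp (-(y - θ) ^ 2 / (2 * r)) /
        ((√(2 * Real.pi * (1 + r)))⁻¹ * Real.exp (-(y - x) ^ 2 / (2 * (1 + r))))
        = (√(2 * Real.pi * (1 + r)) / √(2 * Real.pi * r)) *
          Real.exp (-(y - θ) ^ 2 / (2 * r) - -(y - x) ^ 2 / (2 * (1 + r))) := by
      rw [Real.exp_sub]; field_simp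
    rw [this, Real.log_mul (by positivity) (Real.exp_pos _).ne', Real.log_exp]
    have k1 := le_abs_self (Real.log (√(2 * Real.pi * (1 + r)) / √(2 * Real.pi * r)))
    have k2 : (y - x) ^ 2 / (2 * (1 + (r:ℝ))) ≤ (y - θ) ^ 2 + (x - θ) ^ 2 := by
      rw [div_le_iff₀ (by positivity)]
      nlinarith [sq_nonneg (y - θ + (x - θ)), mul_nonneg hr'.le (sq_nonneg (y - θ)),
        mul_nonneg hr'.le (sq_nonneg (x - θ))]
    have k3 : 0 ≤ (y - θ) ^ 2 / (2 * (r:ℝ)) := by positivity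
    rw [neg_div, neg_div]
    linarith

/-- second-moment tail bound for the standard Gaussian -/
lemma tail_sq {l : ℝ} (hl : 1 ≤ l) :
    Integrable (Set.indicator {x : ℝ | l < |x|} (fun x => x ^ 2)) (gaussianReal 0 1) ∧
    ∫ x, Set.indicator {x : ℝ | l < |x|} (fun x => x ^ 2) x ∂(gaussianReal 0 1)
      ≤ 2 * ((l + 1) * Real.exp (-l ^ 2 / 2)) := by
  have hms : MeasurableSet {x : ℝ | l < |x|} := measurableSet_lt measurable_const (by fun_prop)
  have hsq : Integrable (fun x : ℝ => x ^ 2) (gaussianReal 0 1) := by simpa using gm_sq 0 1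
  refine ⟨hsq.indicator hms, ?_⟩
  rw [integral_gaussianReal_eq_integral_smul one_ne_zero]
  -- the dominating function
  let g' : ℝ → ℝ := fun x => (x ^ 2 + x - 1) * Real.exp (-x ^ 2 / 2)
  have hder : ∀ x ∈ Set.Ici l,
      HasDerivAt (fun x : ℝ => -((x + 1) * Real.exp (-x ^ 2 / 2))) (g' x) x := by
    intro x _
    have h1 : HasDerivAt (fun x : ℝ => -x ^ 2 / 2) (-x) x := by
      have := ((hasDerivAt_pow 2 x).neg).div_const 2
      exact this.congr_deriv (by norm_num; ring)
    have := (((hasDerivAt_id x).add_const 1).mul h1.exp).neg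
    refine this.congr_deriv ?_
    simp only [g', id]
    ring
  have hpos : ∀ x ∈ Set.Ioi l, 0 ≤ g' x := by
    intro x hx
    have hx : l < x := hx
    have : 0 ≤ x ^ 2 + x - 1 := by nlinarith
    exact mul_nonneg this (Real.exp_pos _).le
  have hlim : Tendsto (fun x : ℝ => -((x + 1) * Real.exp (-x ^ 2 / 2))) atTop (nhds 0) := by
    have h0 : Tendsto (fun x : ℝ => (x ^ 1 * Real.exp (-x)) + Real.exp (-x)) atTop (nhds 0) := by
      simpa using (Real.tendsto_pow_mul_exp_neg_atTop_nhds_zero 1).add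
        (Real.tendsto_exp_neg_atTop_nhds_zero)
    have h1 : Tendsto (fun x : ℝ => (x + 1) * Real.exp (-x ^ 2 / 2)) atTop (nhds 0) := by
      apply squeeze_zero' _ _ h0
      · filter_upwards [eventually_ge_atTop 0] with x hx; positivity
      · filter_upwards [eventually_ge_atTop 2] with x hx
        have : Real.exp (-x ^ 2 / 2) ≤ Real.exp (-x) := Real.exp_le_exp.2 (by nlinarith)
        nlinarith
    simpa using h1.neg
  have hI := integrableOn_Ioi_deriv_of_nonneg' hder hpos hlim
  have hE := integral_Ioi_of_hasDerivAt_of_nonneg' hder hpos hlim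
  have hsplit : ∀ x, gaussianPDFReal 0 1 x • Set.indicator {x : ℝ | l < |x|} (fun x => x ^ 2) x
      ≤ (Set.Ioi l).indicator g' x + (Set.Ioi l).indicator g' (-x) := by
    intro x
    have hpdf : gaussianPDFReal 0 1 x ≤ Real.exp (-x ^ 2 / 2) := by
      unfold gaussianPDFReal
      simp only [NNReal.coe_one, mul_one, sub_zero]
      have : (√(2 * Real.pi))⁻¹ ≤ 1 := by
        apply inv_le_one_of_one_le₀
        rw [Real.one_le_sqrt]; nlinarith [Real.pi_gt_three]
      nlinarith [Real.exp_pos (-x ^ 2 / 2)]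
    have key : ∀ z : ℝ, l < z → gaussianPDFReal 0 1 x ≤ Real.exp (-z ^ 2 / 2) →
        gaussianPDFReal 0 1 x * z ^ 2 ≤ g' z := by
      intro z hz h
      have : g' z = (z ^ 2 + z - 1) * Real.exp (-z ^ 2 / 2) := rfl
      rw [this]
      have e := Real.exp_pos (-z ^ 2 / 2)
      nlinarith [mul_le_mul_of_nonneg_right h (sq_nonneg z)]
    have nn : ∀ z, 0 ≤ (Set.Ioi l).indicator g' z := fun z => Set.indicator_nonneg hpos z
    by_cases hx : l < |x|
    · rw [Set.indicator_of_mem (show x ∈ {x : ℝ | l < |x|} from hx), smul_eq_mul]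
      rcases lt_abs.1 hx with h | h
      · rw [Set.indicator_of_mem (show x ∈ Set.Ioi l from h)]
        have := key x h hpdf
        linarith [nn (-x)]
      · rw [Set.indicator_of_mem (show -x ∈ Set.Ioi l from h)]
        have := key (-x) h (by simpa using hpdf)
        rw [neg_sq] at this
        linarith [nn x]
    · rw [Set.indicator_of_notMem (show x ∉ {x : ℝ | l < |x|} from hx), smul_zero]
      linarith [nn x, nn (-x)]
  have hI1 : Integrable ((Set.Ioi l).indicator g') := (integrable_indicator_iff measurableSet_Ioi).2 hI
  have hI2 : Integrable (fun x => (Set.Ioi l).indicator g' (-x)) := hI1.comp_neg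
  have hfin := integral_le_max_zero (μ := volume) (hI1.add hI2) (ae_of_all _ hsplit)
  have e1 : ∫ x, (Set.Ioi l).indicator g' x = (l + 1) * Real.exp (-l ^ 2 / 2) := by
    rw [integral_indicator measurableSet_Ioi, hE]; ring
  have e2 : ∫ x, ((Set.Ioi l).indicator g' + fun x => (Set.Ioi l).indicator g' (-x)) x
      = 2 * ((l + 1) * Real.exp (-l ^ 2 / 2)) := by
    simp only [Pi.add_apply]
    rw [integral_add hI1 hI2, integral_neg_eq_self, e1]; ring
  rw [e2] at hfin
  refine hfin.trans (max_le ?_ le_rfl)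
  have : 0 ≤ l + 1 := by linarith
  positivity

lemma int_clusterPrior (r η : ℝ) (h0 : 0 ≤ η) (h1 : η ≤ 1) (f : ℝ → ℝ) :
    ∫ t, f t ∂(clusterPrior r η) = (1 - η) * f 0 + (η / (2 * clusterK r η)) *
      ∑ k ∈ Finset.Icc 1 (clusterK r η), (f (clusterMu r η k) + f (-(clusterMu r η k))) := by
  have hd : ∀ a : ℝ, Integrable f (Measure.dirac a) := fun a => integrable_dirac (by simp)
  have hk : ∀ k ∈ Finset.Icc 1 (clusterK r η), Integrable f
      (Measure.dirac (clusterMu r η k) + Measure.dirac (-(clusterMu r η k))) :=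
    fun k _ => (hd _).add_measure (hd _)
  unfold clusterPrior
  rw [integral_add_measure ((hd 0).smul_measure (by simp))
    ((integrable_finsetSum_measure.2 hk).smul_measure (by simp)), integral_smul_measure,
    integral_smul_measure, integral_finsetSum_measure hk, integral_dirac,
    ENNReal.toReal_ofReal (by linarith), ENNReal.toReal_ofReal (by positivity)]
  congr 2
  refine Finset.sum_congr rfl fun k _ => ?_
  rw [integral_add_measure (hd _) (hd _), integral_dirac, integral_dirac]

lemma pdf_shift (m x : ℝ) :
    gaussianPDFReal m 1 x = gaussianPDFReal 0 1 x * Real.exp (x * m - m ^ 2 / 2) := by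
  unfold gaussianPDFReal
  rw [mul_assoc (√(2 * Real.pi * (1 : ℝ≥0)))⁻¹, ← Real.exp_add]
  congr 2
  simp only [NNReal.coe_one]
  ring

/-- numerator and denominator of the cluster Bayes predictive density -/
def cNum (r : ℝ≥0) (η x y : ℝ) : ℝ :=
  ∫ θ, gaussianPDFReal θ r y * gaussianPDFReal θ 1 x ∂(clusterPrior (r : ℝ) η)
def cDen (r : ℝ≥0) (η x : ℝ) : ℝ := ∫ θ, gaussianPDFReal θ 1 x ∂(clusterPrior (r : ℝ) η)
def cE (r η x : ℝ) : ℝ := Real.exp (-lamE η ^ 2 / 2) / (2 * clusterK r η) *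
  ∑ k ∈ Finset.Icc 1 (clusterK r η), (Real.exp (x * clusterMu r η k - clusterMu r η k ^ 2 / 2)
    + Real.exp (x * (-clusterMu r η k) - (-clusterMu r η k) ^ 2 / 2))

lemma cNum_meas (r : ℝ≥0) {η : ℝ} (h0 : 0 < η) (h1 : η < 1) (x : ℝ) :
    Measurable (cNum r η x) := by
  have : cNum r η x = fun y => (1 - η) * (gaussianPDFReal 0 r y * gaussianPDFReal 0 1 x) +
      (η / (2 * clusterK r η)) * ∑ k ∈ Finset.Icc 1 (clusterK r η),
      (gaussianPDFReal (clusterMu r η k) r y * gaussianPDFReal (clusterMu r η k) 1 x +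
        gaussianPDFReal (-clusterMu r η k) r y * gaussianPDFReal (-clusterMu r η k) 1 x) := by
    ext y
    exact int_clusterPrior r η h0.le h1.le _
  rw [this]
  have hm := fun m => measurable_gaussianPDFReal m r
  refine Measurable.add (((hm 0).mul_const _).const_mul _) (Measurable.const_mul ?_ _)
  refine Finset.measurable_sum _ fun k _ => ?_
  exact ((hm _).mul_const _).add ((hm _).mul_const _)

lemma cNum_ge_zero (r : ℝ≥0) {η : ℝ} (h0 : 0 < η) (h1 : η < 1) (x y : ℝ) :
    (1 - η) * gaussianPDFReal 0 1 x * gaussianPDFReal 0 r y ≤ cNum r η x y := by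
  unfold cNum
  rw [int_clusterPrior r η h0.le h1.le]
  have : 0 ≤ (η / (2 * clusterK r η)) * ∑ k ∈ Finset.Icc 1 (clusterK r η),
      (gaussianPDFReal (clusterMu r η k) r y * gaussianPDFReal (clusterMu r η k) 1 x +
        gaussianPDFReal (-clusterMu r η k) r y * gaussianPDFReal (-clusterMu r η k) 1 x) := by
    refine mul_nonneg (by positivity) (Finset.sum_nonneg fun k _ => ?_)
    have := gaussianPDFReal_nonneg
    exact add_nonneg (mul_nonneg (this _ _ _) (this _ _ _)) (mul_nonneg (this _ _ _) (this _ _ _))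
  linarith

lemma cNum_ge_atom (r : ℝ≥0) {η : ℝ} (h0 : 0 < η) (h1 : η < 1) (x y : ℝ) {k : ℕ}
    (hk : k ∈ Finset.Icc 1 (clusterK r η)) {m : ℝ}
    (hm : m = clusterMu r η k ∨ m = -clusterMu r η k) :
    (η / (2 * clusterK r η)) * gaussianPDFReal m 1 x * gaussianPDFReal m r y ≤ cNum r η x y := by
  unfold cNum
  rw [int_clusterPrior r η h0.le h1.le]
  have nn : ∀ m, 0 ≤ gaussianPDFReal m r y * gaussianPDFReal m 1 x := fun m =>
    mul_nonneg (gaussianPDFReal_nonneg _ _ _) (gaussianPDFReal_nonneg _ _ _)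
  have hs := Finset.single_le_sum (f := fun k =>
      (gaussianPDFReal (clusterMu r η k) r y * gaussianPDFReal (clusterMu r η k) 1 x +
        gaussianPDFReal (-clusterMu r η k) r y * gaussianPDFReal (-clusterMu r η k) 1 x))
      (fun k _ => add_nonneg (nn _) (nn _)) hk
  have hm' : gaussianPDFReal m r y * gaussianPDFReal m 1 x ≤
      gaussianPDFReal (clusterMu r η k) r y * gaussianPDFReal (clusterMu r η k) 1 x +
        gaussianPDFReal (-clusterMu r η k) r y * gaussianPDFReal (-clusterMu r η k) 1 x := by
    rcases hm with rfl | rfl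
    · linarith [nn (-clusterMu r η k)]
    · linarith [nn (clusterMu r η k)]
  have := mul_le_mul_of_nonneg_left (hm'.trans hs)
    (show 0 ≤ η / (2 * (clusterK r η : ℝ)) by positivity)
  have h2 := mul_nonneg (show 0 ≤ 1 - η by linarith) (nn 0)
  calc _ = η / (2 * (clusterK r η : ℝ)) * (gaussianPDFReal m r y * gaussianPDFReal m 1 x) := by ring
    _ ≤ _ := this
    _ ≤ _ := by linarith

lemma cDen_eq (r : ℝ≥0) {η : ℝ} (h0 : 0 < η) (h1 : η < 1)
    (hE : η = (1 - η) * Real.exp (-lamE η ^ 2 / 2)) (x : ℝ) :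
    cDen r η x = (1 - η) * gaussianPDFReal 0 1 x * (1 + cE r η x) := by
  unfold cDen cE
  rw [int_clusterPrior r η h0.le h1.le]
  have : ∀ k, gaussianPDFReal (clusterMu r η k) 1 x + gaussianPDFReal (-clusterMu r η k) 1 x
      = gaussianPDFReal 0 1 x * (Real.exp (x * clusterMu r η k - clusterMu r η k ^ 2 / 2)
    + Real.exp (x * (-clusterMu r η k) - (-clusterMu r η k) ^ 2 / 2)) := fun k => by
    rw [pdf_shift (clusterMu r η k), pdf_shift (-clusterMu r η k)]; ring
  simp_rw [this]
  rw [← Finset.mul_sum]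
  conv_lhs => rw [show η / (2 * (clusterK r η : ℝ)) =
    ((1 - η) * Real.exp (-lamE η ^ 2 / 2)) / (2 * (clusterK r η : ℝ)) by rw [← hE]]
  ring

lemma cE_nonneg (r η x : ℝ) : 0 ≤ cE r η x := by unfold cE; positivity

lemma cE_le_one (r : ℝ) {η x : ℝ} (hx : |x| ≤ lamE η) : cE r η x ≤ 1 := by
  unfold cE
  have hx2 : x ^ 2 ≤ lamE η ^ 2 := by
    rw [← sq_abs]; gcongr
  have hb : ∀ m : ℝ, Real.exp (x * m - m ^ 2 / 2) ≤ Real.exp (lamE η ^ 2 / 2) := fun m =>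
    Real.exp_le_exp.2 (by nlinarith [sq_nonneg (x - m)])
  have hs := Finset.sum_le_card_nsmul (Finset.Icc 1 (clusterK r η)) (fun k =>
    (Real.exp (x * clusterMu r η k - clusterMu r η k ^ 2 / 2)
    + Real.exp (x * (-clusterMu r η k) - (-clusterMu r η k) ^ 2 / 2)))
    (2 * Real.exp (lamE η ^ 2 / 2)) (fun k _ => by linarith [hb (clusterMu r η k), hb (-clusterMu r η k)])
  rw [Nat.card_Icc, Nat.add_sub_cancel, nsmul_eq_mul] at hs
  refine (mul_le_mul_of_nonneg_left hs (by positivity)).trans ?_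
  rcases Nat.eq_zero_or_pos (clusterK r η) with h | h
  · simp [h]
  · have : (0 : ℝ) < clusterK r η := by exact_mod_cast h
    have e : Real.exp (-lamE η ^ 2 / 2) * Real.exp (lamE η ^ 2 / 2) = 1 := by
      rw [← Real.exp_add]; ring_nf; simp
    apply le_of_eq
    calc _ = Real.exp (-lamE η ^ 2 / 2) * Real.exp (lamE η ^ 2 / 2) := by field_simp
      _ = 1 := e

lemma cE_int (r η : ℝ) : Integrable (cE r η) (gaussianReal 0 1) ∧
    ∫ x, cE r η x ∂(gaussianReal 0 1) ≤ Real.exp (-lamE η ^ 2 / 2) := by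
  have hi : ∀ m : ℝ, Integrable (fun x => Real.exp (x * m - m ^ 2 / 2)) (gaussianReal 0 1) := by
    intro m
    have := (integrable_exp_mul_gaussianReal (μ := 0) (v := 1) m).mul_const (Real.exp (-(m ^ 2 / 2)))
    refine this.congr (ae_of_all _ fun x => ?_)
    simp only
    rw [← Real.exp_add]; ring_nf
  have hv : ∀ m : ℝ, ∫ x, Real.exp (x * m - m ^ 2 / 2) ∂(gaussianReal 0 1) = 1 := by
    intro m
    have h := congrFun (mgf_id_gaussianReal (μ := 0) (v := 1)) m
    simp only [mgf, id] at h
    have : ∀ x : ℝ, Real.exp (x * m - m ^ 2 / 2) = Real.exp (m * x) * Real.exp (-(m ^ 2 / 2)) := by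
      intro x; rw [← Real.exp_add]; ring_nf
    simp_rw [this]
    rw [integral_mul_const, h, ← Real.exp_add]
    simp
  have hi2 : ∀ k ∈ Finset.Icc 1 (clusterK r η), Integrable (fun x =>
    (Real.exp (x * clusterMu r η k - clusterMu r η k ^ 2 / 2)
    + Real.exp (x * (-clusterMu r η k) - (-clusterMu r η k) ^ 2 / 2))) (gaussianReal 0 1) :=
    fun k _ => (hi _).add (hi _)
  unfold cE
  refine ⟨(integrable_finsetSum _ hi2).const_mul _, ?_⟩
  rw [integral_const_mul, integral_finsetSum _ hi2]
  have : ∀ k ∈ Finset.Icc 1 (clusterK r η), ∫ x,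
    (Real.exp (x * clusterMu r η k - clusterMu r η k ^ 2 / 2)
    + Real.exp (x * (-clusterMu r η k) - (-clusterMu r η k) ^ 2 / 2)) ∂(gaussianReal 0 1) = 2 := by
    intro k _
    rw [integral_add (hi _) (hi _), hv, hv]; norm_num
  rw [Finset.sum_congr rfl this]
  simp only [Finset.sum_const, Nat.card_Icc, Nat.add_sub_cancel, nsmul_eq_mul]
  rcases Nat.eq_zero_or_pos (clusterK r η) with h | h
  · simp [h, Real.exp_nonneg]
  · have : (0 : ℝ) < clusterK r η := by exact_mod_cast h
    apply le_of_eq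
    field_simp

lemma kl_zero {r : ℝ≥0} (hr : 0 < r) {η : ℝ} (h0 : 0 < η) (h1 : η < 1)
    (hE : η = (1 - η) * Real.exp (-lamE η ^ 2 / 2)) (θ : ℝ) {x : ℝ} (hx : |x| ≤ lamE η) :
    KLdiv (gaussianReal θ r) (pTCL r η x) ≤ cE r η x + θ ^ 2 / (2 * r) := by
  have hp := gaussianPDFReal_pos 0 1 x one_ne_zero
  have h1' : 0 < 1 - η := by linarith
  have hc : 0 < (1 - η) * gaussianPDFReal 0 1 x := mul_pos h1' hp
  have hn := cE_nonneg r η x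
  rw [pTCL, if_pos hx]
  have := KLdiv_bayes_le hr θ 0 ((1 - η) * gaussianPDFReal 0 1 x) (cDen r η x) (cDen r η x)
    (cNum_meas r h0 h1 x) hc (by rw [cDen_eq r h0 h1 hE]; positivity) le_rfl
    (cNum_ge_zero r h0 h1 x)
  refine this.trans (max_le (by positivity) ?_)
  rw [cDen_eq r h0 h1 hE, mul_div_cancel_left₀ _ hc.ne', sub_zero]
  have := Real.log_le_sub_one_of_pos (show 0 < 1 + cE r η x by linarith)
  linarith

lemma kl_atom {r : ℝ≥0} (hr : 0 < r) {η : ℝ} (h0 : 0 < η) (h1 : η < 1)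
    (hE : η = (1 - η) * Real.exp (-lamE η ^ 2 / 2)) (θ : ℝ) {x : ℝ} (hx : |x| ≤ lamE η) {k : ℕ}
    (hk : k ∈ Finset.Icc 1 (clusterK r η)) {m : ℝ}
    (hm : m = clusterMu r η k ∨ m = -clusterMu r η k) :
    KLdiv (gaussianReal θ r) (pTCL r η x) ≤ max 0 (Real.log 2 + lamE η ^ 2 / 2 +
      Real.log (2 * clusterK r η) - x * m + m ^ 2 / 2 + (θ - m) ^ 2 / (2 * r)) := by
  have hp := gaussianPDFReal_pos 0 1 x one_ne_zero
  have hpm := gaussianPDFReal_pos m 1 x one_ne_zero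
  have h1' : 0 < 1 - η := by linarith
  have hK : (0:ℝ) < clusterK r η := by
    have := Finset.mem_Icc.1 hk
    exact_mod_cast (by omega : 0 < clusterK r η)
  have hc : 0 < (η / (2 * clusterK r η)) * gaussianPDFReal m 1 x := by positivity
  have hn := cE_nonneg r η x
  rw [pTCL, if_pos hx]
  have := KLdiv_bayes_le hr θ m ((η / (2 * clusterK r η)) * gaussianPDFReal m 1 x)
    ((1 - η) * gaussianPDFReal 0 1 x * 2) (cDen r η x)
    (cNum_meas r h0 h1 x) hc (by rw [cDen_eq r h0 h1 hE]; positivity)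
    (by
      rw [cDen_eq r h0 h1 hE]
      have := cE_le_one r hx
      gcongr; linarith)
    (fun y => cNum_ge_atom r h0 h1 x y hk hm)
  refine this.trans (max_le_max le_rfl (le_of_eq ?_))
  congr 1
  have e : (1 - η) * gaussianPDFReal 0 1 x * 2 / ((η / (2 * clusterK r η)) * gaussianPDFReal m 1 x)
      = 2 * (2 * clusterK r η) * Real.exp (lamE η ^ 2 / 2 - x * m + m ^ 2 / 2) := by
    rw [pdf_shift m, div_eq_iff (by positivity)]
    have e2 : Real.exp (lamE η ^ 2 / 2 - x * m + m ^ 2 / 2) * Real.exp (x * m - m ^ 2 / 2) * η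
        = 1 - η := by
      have e3 : Real.exp (lamE η ^ 2 / 2) * ((1 - η) * Real.exp (-lamE η ^ 2 / 2)) = 1 - η := by
        rw [mul_left_comm, ← Real.exp_add, neg_div, add_neg_cancel, Real.exp_zero, mul_one]
      rw [← hE] at e3
      rw [← Real.exp_add, ← e3]
      congr 2
      ring
    calc _ = (1 - η) * gaussianPDFReal 0 1 x * 2 := rfl
      _ = (Real.exp (lamE η ^ 2 / 2 - x * m + m ^ 2 / 2) * Real.exp (x * m - m ^ 2 / 2) * η)
          * gaussianPDFReal 0 1 x * 2 := by rw [e2]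
      _ = _ := by field_simp
  rw [e, Real.log_mul (by positivity) (by positivity), Real.log_mul (by positivity) (by positivity),
    Real.log_exp]
  ring

lemma risk_zero_bd {r : ℝ≥0} (hr : 0 < r) {η : ℝ} (h0 : 0 < η) (h1 : η < 1)
    (hE : η = (1 - η) * Real.exp (-lamE η ^ 2 / 2)) (θ : ℝ) : risk1 r θ (pTCL r η) ≤ θ ^ 2 / (2 * r) + Cr r + 2 := by
  have hC := Cr_nonneg r
  have hint := (gm_sq θ 1).add (integrable_const (θ ^ 2 / (2 * r) + Cr r + 1))
  have := integral_le_max_zero (f := fun x => KLdiv (gaussianReal θ r) (pTCL r η x)) hint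
    (ae_of_all _ fun x => ?_)
  · simp only [Pi.add_apply] at this
    rw [integral_add (gm_sq θ 1) (integrable_const _), gm_sq_int] at this
    simp only [integral_const, probReal_univ, one_smul] at this
    refine this.trans (max_le (by positivity) ?_)
    push_cast; linarith
  · simp only [Pi.add_apply]
    have q : 0 ≤ θ ^ 2 / (2 * (r:ℝ)) := by positivity
    by_cases hx : |x| ≤ lamE η
    · have h1 := kl_zero hr h0 h1 hE θ hx
      have := cE_le_one r hx
      nlinarith [sq_nonneg (x - θ)]
    · have := KLdiv_gauss_le hr θ x
      rw [pTCL, if_neg hx]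
      linarith

lemma risk_atom_bd {r : ℝ≥0} (hr : 0 < r) {η : ℝ} (h0 : 0 < η) (h1 : η < 1)
    (hE : η = (1 - η) * Real.exp (-lamE η ^ 2 / 2)) (θ : ℝ) {k : ℕ} (hk : k ∈ Finset.Icc 1 (clusterK r η)) {m : ℝ}
    (hm : m = clusterMu r η k ∨ m = -clusterMu r η k) :
    risk1 r θ (pTCL r η) ≤ max 0 (lamE η ^ 2 / 2 - θ * m + m ^ 2 / 2 + (θ - m) ^ 2 / (2 * r)) +
      Real.log (2 * clusterK r η) + 2 * |m| + Cr r + 2 := by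
  have hC := Cr_nonneg r
  have hK : (1:ℝ) ≤ clusterK r η := by
    have := Finset.mem_Icc.1 hk
    exact_mod_cast (by omega : 1 ≤ clusterK r η)
  have hlK : 0 ≤ Real.log (2 * clusterK r η) := Real.log_nonneg (by linarith)
  set Q := max 0 (lamE η ^ 2 / 2 - θ * m + m ^ 2 / 2 + (θ - m) ^ 2 / (2 * r)) with hQ
  have hQ0 : 0 ≤ Q := le_max_left _ _
  have hQ1 : lamE η ^ 2 / 2 - θ * m + m ^ 2 / 2 + (θ - m) ^ 2 / (2 * r) ≤ Q := le_max_right _ _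
  have hint := ((gm_sq θ 1).const_mul (1 + |m|)).add
    (integrable_const (Q + Real.log (2 * clusterK r η) + |m| + Cr r + 1))
  have := integral_le_max_zero (f := fun x => KLdiv (gaussianReal θ r) (pTCL r η x)) hint
    (ae_of_all _ fun x => ?_)
  · simp only [Pi.add_apply] at this
    rw [integral_add ((gm_sq θ 1).const_mul _) (integrable_const _), integral_const_mul,
      gm_sq_int] at this
    simp only [integral_const, probReal_univ, one_smul] at this
    refine this.trans (max_le (by positivity) ?_)
    push_cast; linarith
  · simp only [Pi.add_apply]
    have hm0 := abs_nonneg m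
    by_cases hx : |x| ≤ lamE η
    · have h1 := kl_atom hr h0 h1 hE θ hx hk hm
      have hl2 : Real.log 2 ≤ 1 := by linarith [Real.log_two_lt_d9]
      have h3 : -((x - θ) * m) ≤ |m| * (1 + (x - θ) ^ 2) := by
        have a1 : -((x - θ) * m) ≤ |x - θ| * |m| := by rw [← abs_mul]; exact neg_le_abs _
        have a2 : |x - θ| ≤ 1 + (x - θ) ^ 2 := by
          rw [← sq_abs]; nlinarith [sq_nonneg (|x - θ| - 1), abs_nonneg (x - θ)]
        nlinarith
      refine h1.trans (max_le ?_ ?_)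
      · positivity
      · nlinarith [sq_nonneg (x - θ)]
    · have := KLdiv_gauss_le hr θ x
      rw [pTCL, if_neg hx]
      nlinarith [sq_nonneg (x - θ), mul_nonneg hm0 (sq_nonneg (x - θ))]

lemma risk_far_bd {r : ℝ≥0} (hr : 0 < r) {η : ℝ} (h0 : 0 < η) (h1 : η < 1)
    (hE : η = (1 - η) * Real.exp (-lamE η ^ 2 / 2)) (θ : ℝ) (hθ : lamE η ≤ |θ|) : risk1 r θ (pTCL r η) ≤
    Real.exp (-(|θ| - lamE η) ^ 2 / 2) * (θ ^ 2 / (2 * r) + 1) + Cr r + 1 := by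
  have hC := Cr_nonneg r
  obtain ⟨σ, hσ, hσθ⟩ : ∃ σ : ℝ, |σ| = 1 ∧ σ * θ = |θ| := by
    rcases le_total 0 θ with h | h
    · exact ⟨1, by simp, by simp [abs_of_nonneg h]⟩
    · exact ⟨-1, by simp, by simp [abs_of_nonpos h]⟩
  have hσ2 : σ ^ 2 = 1 := by rw [← sq_abs, hσ]; norm_num
  set s := |θ| - lamE η with hs
  have hs0 : 0 ≤ s := by linarith
  set A := θ ^ 2 / (2 * (r:ℝ)) + 1 with hA
  have hA0 : 0 ≤ A := by positivity
  have hexp : Integrable (fun x => Real.exp (-s * σ * x) * (Real.exp (s * lamE η) * A))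
    (gaussianReal θ 1) := (integrable_exp_mul_gaussianReal (-s * σ)).mul_const _
  have hexpv : ∫ x, Real.exp (-s * σ * x) * (Real.exp (s * lamE η) * A) ∂(gaussianReal θ 1)
      = Real.exp (-s ^ 2 / 2) * A := by
    have h := congrFun (mgf_id_gaussianReal (μ := θ) (v := 1)) (-s * σ)
    simp only [mgf, id] at h
    rw [integral_mul_const, h, ← mul_assoc, ← Real.exp_add]
    congr 2
    have : (-s * σ) ^ 2 = s ^ 2 := by rw [mul_pow, hσ2]; ring
    rw [this]
    have : θ * (-s * σ) = -s * |θ| := by rw [← hσθ]; ring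
    rw [this, show |θ| = s + lamE η by rw [hs]; ring]
    push_cast; ring
  have hsum : Integrable (fun x => (x - θ) ^ 2 + Cr r) (gaussianReal θ 1) :=
    (gm_sq θ 1).add (integrable_const (Cr r))
  have hint := hexp.add hsum
  have := integral_le_max_zero (f := fun x => KLdiv (gaussianReal θ r) (pTCL r η x)) hint
    (ae_of_all _ fun x => ?_)
  · simp only [Pi.add_apply] at this
    rw [integral_add hexp hsum, hexpv,
      integral_add (gm_sq θ 1) (integrable_const _), gm_sq_int] at this
    simp only [integral_const, probReal_univ, one_smul] at this
    refine this.trans (max_le (by positivity) ?_)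
    push_cast; linarith
  · simp only [Pi.add_apply]
    by_cases hx : |x| ≤ lamE η
    · have h1 := kl_zero hr h0 h1 hE θ hx
      have := cE_le_one r hx
      have hσx : σ * x ≤ lamE η := by
        calc σ * x ≤ |σ * x| := le_abs_self _
          _ = |x| := by rw [abs_mul, hσ, one_mul]
          _ ≤ _ := hx
      have e1 : 1 ≤ Real.exp (-s * σ * x) * Real.exp (s * lamE η) := by
        rw [← Real.exp_add]
        apply Real.one_le_exp
        nlinarith
      have := mul_le_mul_of_nonneg_right e1 hA0
      nlinarith [sq_nonneg (x - θ)]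
    · have := KLdiv_gauss_le hr θ x
      rw [pTCL, if_neg hx]
      have : 0 ≤ Real.exp (-s * σ * x) * (Real.exp (s * lamE η) * A) := by positivity
      linarith

lemma risk_at_zero {r : ℝ≥0} (hr : 0 < r) {η : ℝ} (h0 : 0 < η) (h1 : η < 1)
    (hE : η = (1 - η) * Real.exp (-lamE η ^ 2 / 2)) (hl : 1 ≤ lamE η) : risk1 r 0 (pTCL r η) ≤
    Real.exp (-lamE η ^ 2 / 2) * (1 + (Cr r + 1) * (2 * (lamE η + 1))) := by
  have hC := Cr_nonneg r
  obtain ⟨t1, t2⟩ := tail_sq hl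
  obtain ⟨c1, c2⟩ := cE_int r η
  have hint := c1.add (t1.const_mul (Cr r + 1))
  have := integral_le_max_zero (f := fun x => KLdiv (gaussianReal 0 r) (pTCL r η x)) hint
    (ae_of_all _ fun x => ?_)
  · simp only [Pi.add_apply] at this
    rw [integral_add c1 (t1.const_mul _), integral_const_mul] at this
    refine this.trans (max_le (by positivity) ?_)
    nlinarith [mul_le_mul_of_nonneg_left t2 (show 0 ≤ Cr r + 1 by linarith)]
  · simp only [Pi.add_apply]
    have hn := cE_nonneg r η x
    by_cases hx : |x| ≤ lamE η
    · have h1 := kl_zero hr h0 h1 hE 0 hx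
      rw [Set.indicator_of_notMem (by simpa using hx)]
      simpa using h1
    · have := KLdiv_gauss_le hr 0 x
      rw [pTCL, if_neg hx, Set.indicator_of_mem (by simpa using hx)]
      have hx' : 1 ≤ |x| := by linarith
      have : 1 ≤ x ^ 2 := by rw [← sq_abs]; nlinarith
      rw [sub_zero] at *
      nlinarith


lemma clusterMu_pos_mono {r η : ℝ} (hr : 0 < r) (hν : 0 < nuEta r η) {i j : ℕ} (h : i ≤ j) :
    clusterMu r η i ≤ clusterMu r η j := by
  unfold clusterMu
  have : (1 + 2 * r) ^ (i - 1) ≤ (1 + 2 * r) ^ (j - 1) :=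
    pow_le_pow_right₀ (by linarith) (by omega)
  gcongr

lemma clusterMu_ge {r η : ℝ} (hr : 0 < r) (hν : 1 ≤ nuEta r η) {k : ℕ} (hk : 1 ≤ k) :
    1 + 2 * r * ((k : ℝ) - 1) ≤ clusterMu r η k := by
  unfold clusterMu
  have h := one_add_mul_le_pow (show (-2 : ℝ) ≤ 2 * r by linarith) (k - 1)
  rw [Nat.cast_sub hk] at h
  have : 0 < (1 + 2 * r) ^ (k - 1) := by positivity
  push_cast at h
  nlinarith

lemma clusterK_facts {r η B : ℝ} (hr : 0 < r) (hν : 1 ≤ nuEta r η)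
    (hB : lamE η + aEta r η ≤ B) (hB0 : 0 ≤ B) :
    (clusterK r η : ℝ) ≤ 1 + B / (2 * r) ∧
    ∀ n : ℕ, 1 ≤ n → clusterMu r η n ≤ lamE η + aEta r η → n ≤ clusterK r η := by
  have hsub : {k : ℕ | 1 ≤ k ∧ clusterMu r η k ≤ lamE η + aEta r η} ⊆
      (Finset.Icc 1 ⌊1 + B / (2 * r)⌋₊ : Finset ℕ) := by
    rintro k ⟨hk1, hk2⟩
    rw [Finset.coe_Icc]
    refine ⟨hk1, Nat.le_floor ?_⟩
    have h := clusterMu_ge hr hν hk1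
    rw [← sub_le_iff_le_add', le_div_iff₀ (by positivity)]
    nlinarith
  have hfin : {k : ℕ | 1 ≤ k ∧ clusterMu r η k ≤ lamE η + aEta r η}.Finite :=
    (Finset.finite_toSet _).subset hsub
  constructor
  · have h := Set.ncard_le_ncard hsub (Finset.finite_toSet _)
    rw [Set.ncard_coe_finset, Nat.card_Icc, Nat.add_sub_cancel] at h
    have : (clusterK r η : ℝ) ≤ (⌊1 + B / (2 * r)⌋₊ : ℝ) := by exact_mod_cast h
    exact this.trans (Nat.floor_le (by positivity))
  · intro n hn hle
    have hsub2 : ((Finset.Icc 1 n : Finset ℕ) : Set ℕ) ⊆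
        {k : ℕ | 1 ≤ k ∧ clusterMu r η k ≤ lamE η + aEta r η} := by
      intro k hk
      rw [Finset.coe_Icc] at hk
      exact ⟨hk.1, (clusterMu_pos_mono hr (by linarith) hk.2).trans hle⟩
    have h := Set.ncard_le_ncard hsub2 hfin
    rw [Set.ncard_coe_finset, Nat.card_Icc, Nat.add_sub_cancel] at h
    exact h

lemma exists_cluster {r η t : ℝ} (hr : 0 < r) (hν : 1 ≤ nuEta r η) (ht : nuEta r η ≤ t) :
    ∃ n : ℕ, 1 ≤ n ∧ clusterMu r η n ≤ t ∧ t ≤ (1 + 2 * r) * clusterMu r η n := by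
  classical
  have hex : ∃ n : ℕ, t < clusterMu r η (n + 1) := by
    obtain ⟨n, hn⟩ := exists_nat_gt (t / (2 * r))
    refine ⟨n, ?_⟩
    have h := clusterMu_ge hr hν (Nat.succ_pos n)
    rw [div_lt_iff₀ (by positivity)] at hn
    push_cast [Nat.succ_eq_add_one] at h
    nlinarith
  have hs := Nat.find_spec hex
  set n := Nat.find hex with hn
  have hn1 : 1 ≤ n := by
    rcases Nat.eq_zero_or_pos n with h | h
    · rw [h] at hs
      simp [clusterMu] at hs
      linarith
    · exact h
  refine ⟨n, hn1, ?_, ?_⟩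
  · have := Nat.find_min hex (m := n - 1) (by omega)
    rw [Nat.sub_add_cancel hn1] at this
    exact not_lt.1 this
  · have : clusterMu r η (n + 1) = (1 + 2 * r) * clusterMu r η n := by
      unfold clusterMu
      rw [← mul_assoc, ← pow_succ']
      congr 2
      omega
    linarith

/-- the uniform constant -/
def Cu (r : ℝ≥0) : ℝ := Cr r + 10 + 2 / r + ((√(vw r))⁻¹ + 2) / r

set_option maxHeartbeats 1000000 in
lemma risk_uniform {r : ℝ≥0} (hr : 0 < r) {η : ℝ} (h0 : 0 < η) (h1 : η < 1)
    (hE : η = (1 - η) * Real.exp (-lamE η ^ 2 / 2)) (hL : 8 ≤ lamE η)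
    (hLf : 2 ≤ √(vw r) * lamE η) (θ : ℝ) :
    risk1 r θ (pTCL r η) ≤ lamE η ^ 2 / (2 * (1 + r)) + Cu r * (lamE η * √(lamE η)) := by
  have hr' : (0 : ℝ) < r := hr
  have hC := Cr_nonneg r
  set L := lamE η with hLdef
  set w := √(vw r) with hw
  have hvw0 : 0 < vw r := by unfold vw; positivity
  have hvw1 : vw r ≤ 1 := by unfold vw; rw [div_le_one (by positivity)]; linarith
  have hw0 : 0 < w := Real.sqrt_pos.2 hvw0
  have hw2 : w ^ 2 = vw r := Real.sq_sqrt hvw0.le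
  have hw1 : w ≤ 1 := by rw [hw, Real.sqrt_le_iff]; exact ⟨zero_le_one, by simpa using hvw1⟩
  set a := aEta r η with ha
  have hf : lamF r η = w * L := rfl
  have ha0 : 0 ≤ a := Real.sqrt_nonneg _
  have ha2 : a ^ 2 = 2 * Real.log (w * L) := by
    rw [ha, aEta, Real.sq_sqrt, hf]
    rw [hf]
    have := Real.log_nonneg (show 1 ≤ w * L by linarith)
    linarith
  have ha2L : a ^ 2 ≤ 2 * L := by
    have := Real.log_le_sub_one_of_pos (show 0 < w * L by linarith)
    nlinarith
  set q := √L with hq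
  have hq0 : 0 ≤ q := Real.sqrt_nonneg _
  have hq2 : q ^ 2 = L := Real.sq_sqrt (by linarith)
  have hq1 : 1 ≤ q := by rw [hq, Real.one_le_sqrt]; linarith
  have haq : a ≤ 2 * q := by
    apply abs_le_of_sq_le_sq' _ (by linarith) |>.2
    nlinarith
  have haL : a ≤ L / 2 := by
    apply abs_le_of_sq_le_sq' _ (by linarith) |>.2
    nlinarith
  set W := L * q with hW
  have hWL : L ≤ W := by nlinarith
  have haW : a * L ≤ 2 * W := by nlinarith
  -- mu and nu
  have hmu : muEta r η = √(a ^ 2 + L ^ 2) - a := rfl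
  have hmu_le : muEta r η ≤ L := by
    rw [hmu]
    have : √(a ^ 2 + L ^ 2) ≤ a + L := Real.sqrt_le_iff.2 ⟨by linarith, by nlinarith⟩
    linarith
  have hmu_ge : L - a ≤ muEta r η := by
    rw [hmu]
    have : L ≤ √(a ^ 2 + L ^ 2) := Real.le_sqrt_of_sq_le (by nlinarith)
    linarith
  set ν := nuEta r η with hν
  have hνe : ν = w * muEta r η := rfl
  have hν1 : 1 ≤ ν := by
    rw [hνe]
    have := mul_le_mul_of_nonneg_left (show L / 2 ≤ muEta r η by linarith) hw0.le
    linarith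
  have hνle : ν ≤ w * L := by rw [hνe]; gcongr
  have hν2le : ν ^ 2 ≤ vw r * L ^ 2 := by
    calc ν ^ 2 ≤ (w * L) ^ 2 := by gcongr
      _ = _ := by rw [mul_pow, hw2]
  have hν2ge : vw r * L ^ 2 - 2 * (a * L) ≤ ν ^ 2 := by
    have : ν ^ 2 = vw r * (muEta r η) ^ 2 := by rw [hνe, mul_pow, hw2]
    rw [this]
    have h : (L - a) ^ 2 ≤ (muEta r η) ^ 2 := by
      have : 0 ≤ L - a := by linarith
      gcongr
    have h3 : L ^ 2 - 2 * (a * L) ≤ (muEta r η) ^ 2 := by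
      linarith [sq_nonneg a, show (L - a) ^ 2 = L ^ 2 - 2 * (a * L) + a ^ 2 by ring]
    have h4 := mul_le_mul_of_nonneg_left h3 hvw0.le
    have h5 : vw r * (a * L) ≤ a * L :=
      mul_le_of_le_one_left (mul_nonneg ha0 (by linarith)) hvw1
    linarith
  have hvwL : vw r * L ^ 2 / (2 * r) = L ^ 2 / (2 * (1 + r)) := by unfold vw; field_simp
  have hvwL2 : L ^ 2 / 2 - vw r * L ^ 2 / 2 = L ^ 2 / (2 * (1 + r)) := by
    unfold vw; field_simp; ring
  have hu : 0 ≤ L ^ 2 / (2 * (1 + (r:ℝ))) := by positivity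
  have hr2 : 0 ≤ 2 / (r:ℝ) := by positivity
  have hr3 : 0 ≤ (w⁻¹ + 2) / (r:ℝ) := by positivity
  have hW1 : 1 ≤ W := by linarith
  rcases le_or_gt |θ| ν with hc1 | hc1
  · have h := risk_zero_bd hr h0 h1 hE θ
    have h2 : θ ^ 2 / (2 * r) ≤ L ^ 2 / (2 * (1 + r)) := by
      rw [← hvwL]
      have : θ ^ 2 ≤ vw r * L ^ 2 := by
        rw [← sq_abs]
        refine le_trans ?_ hν2le
        gcongr
      gcongr
    have h3 : Cr r + 2 ≤ Cu r * W := by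
      have : Cr r + 2 ≤ Cu r := by unfold Cu; linarith
      exact this.trans (le_mul_of_one_le_right (by linarith) hW1)
    linarith
  rcases le_or_gt |θ| (L + a) with hc2 | hc2
  · obtain ⟨n, hn1, hn2, hn3⟩ := exists_cluster hr' hν1 hc1.le
    obtain ⟨hK, hmem⟩ := clusterK_facts (r := r) (η := η) (B := 2 * L) hr' hν1
      (by rw [← hLdef, ← ha]; linarith) (by linarith)
    have hk : n ∈ Finset.Icc 1 (clusterK r η) :=
      Finset.mem_Icc.2 ⟨hn1, hmem n hn1 (hn2.trans hc2)⟩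
    set μ := clusterMu r η n with hμ
    have hμν : ν ≤ μ := by
      have := clusterMu_pos_mono hr' (show 0 < nuEta r η by linarith) hn1
      have e : clusterMu r η 1 = ν := by simp [clusterMu, hν]
      linarith
    obtain ⟨m, hm, hmm, hθm⟩ : ∃ m : ℝ, (m = μ ∨ m = -μ) ∧ |m| = μ ∧ θ * m = |θ| * μ := by
      rcases le_total 0 θ with h | h
      · exact ⟨μ, Or.inl rfl, abs_of_nonneg (by linarith), by rw [abs_of_nonneg h]⟩
      · exact ⟨-μ, Or.inr rfl, by rw [abs_neg, abs_of_nonneg (by linarith)],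
          by rw [abs_of_nonpos h]; ring⟩
    have h := risk_atom_bd hr h0 h1 hE θ hk hm
    rw [hmm] at h
    have hm2 : m ^ 2 = μ ^ 2 := by rw [← sq_abs, hmm]
    have hd : (θ - m) ^ 2 = (|θ| - μ) ^ 2 := by
      have : (θ - m) ^ 2 = θ ^ 2 - 2 * (θ * m) + m ^ 2 := by ring
      rw [this, hθm, hm2, ← sq_abs θ]; ring
    rw [hθm, hm2, hd] at h
    set t := |θ| with ht
    have hquad : (t - μ) ^ 2 / (2 * r) ≤ (t - μ) * μ := by
      rw [div_le_iff₀ (by positivity)]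
      have : 0 ≤ (t - μ) * ((1 + 2 * r) * μ - t) := mul_nonneg (by linarith) (by linarith)
      linarith
    have hQ : max 0 (L ^ 2 / 2 - t * μ + μ ^ 2 / 2 + (t - μ) ^ 2 / (2 * r))
        ≤ L ^ 2 / (2 * (1 + r)) + 2 * W := by
      refine max_le (by positivity) ?_
      have : ν ^ 2 ≤ μ ^ 2 := by gcongr
      linarith
    have hlogK : Real.log (2 * clusterK r η) ≤ 2 + 2 / r * W := by
      have hK1 : (1:ℝ) ≤ clusterK r η := by
        have := Finset.mem_Icc.1 hk
        exact_mod_cast (by omega : 1 ≤ clusterK r η)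
      have := Real.log_le_sub_one_of_pos (show (0:ℝ) < 2 * clusterK r η by linarith)
      have e : 2 * L / (2 * (r:ℝ)) * 2 = 2 / r * L := by field_simp
      have := mul_le_mul_of_nonneg_left hWL hr2
      linarith
    have hμL : μ ≤ 3 / 2 * L := by linarith
    have : Cu r * W = (Cr r + 10) * W + 2 / r * W + (w⁻¹ + 2) / r * W := by unfold Cu; ring
    have h7 : 0 ≤ (w⁻¹ + 2) / r * W := by positivity
    have h8 := mul_le_mul_of_nonneg_left hW1 hC
    have h9 : 8 ≤ W := by linarith
    rw [this]
    linarith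
  · have h := risk_far_bd hr h0 h1 hE θ (by linarith)
    rw [← hLdef] at h
    set s := |θ| - L with hs
    have hsa : a ≤ s := by linarith
    have e1 : Real.exp (-s ^ 2 / 2) ≤ (w * L)⁻¹ := by
      have : (w * L)⁻¹ = Real.exp (-a ^ 2 / 2) := by
        rw [neg_div, Real.exp_neg, ha2, mul_div_cancel_left₀ _ two_ne_zero, Real.exp_log (by linarith)]
      rw [this]
      apply Real.exp_le_exp.2
      have : a ^ 2 ≤ s ^ 2 := by gcongr
      linarith
    have e2 : s ^ 2 * Real.exp (-s ^ 2 / 2) ≤ 2 := by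
      have h1 := Real.add_one_le_exp (s ^ 2 / 2)
      have h2 : Real.exp (s ^ 2 / 2) * Real.exp (-s ^ 2 / 2) = 1 := by
        rw [← Real.exp_add]; ring_nf; simp
      have h3 := Real.exp_pos (-s ^ 2 / 2)
      have h4 := mul_le_mul_of_nonneg_right h1 h3.le
      rw [h2] at h4
      linarith
    have e3 : Real.exp (-s ^ 2 / 2) ≤ 1 := Real.exp_le_one_iff.2 (by linarith [sq_nonneg s])
    have e4 : L ^ 2 * Real.exp (-s ^ 2 / 2) ≤ w⁻¹ * L := by
      calc _ ≤ L ^ 2 * (w * L)⁻¹ := by gcongr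
        _ = _ := by field_simp
    have hθ2 : θ ^ 2 ≤ 2 * L ^ 2 + 2 * s ^ 2 := by
      rw [← sq_abs, show |θ| = L + s by rw [hs]; ring]
      linarith [sq_nonneg (L - s), show (L + s) ^ 2 + (L - s) ^ 2 = 2 * L ^ 2 + 2 * s ^ 2 by ring]
    have e5 : Real.exp (-s ^ 2 / 2) * (θ ^ 2 / (2 * r)) ≤ (w⁻¹ * L + 2) / r := by
      have : Real.exp (-s ^ 2 / 2) * θ ^ 2 ≤ 2 * (w⁻¹ * L + 2) := by
        have := mul_le_mul_of_nonneg_left hθ2 (Real.exp_pos (-s ^ 2 / 2)).le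
        linarith
      calc _ = (Real.exp (-s ^ 2 / 2) * θ ^ 2) / (2 * r) := by ring
        _ ≤ (2 * (w⁻¹ * L + 2)) / (2 * r) := by gcongr
        _ = _ := by field_simp
    have e6 : (w⁻¹ * L + 2) / r ≤ (w⁻¹ + 2) / r * W := by
      rw [div_mul_eq_mul_div]
      have hwi : 0 < w⁻¹ := by positivity
      have : w⁻¹ * L + 2 ≤ (w⁻¹ + 2) * W := by
        have := mul_le_mul_of_nonneg_left hWL hwi.le
        linarith
      gcongr
    have : Cu r * W = (Cr r + 10) * W + 2 / r * W + (w⁻¹ + 2) / r * W := by unfold Cu; ring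
    have h7 : 0 ≤ 2 / r * W := by positivity
    have h8 := mul_le_mul_of_nonneg_left hW1 hC
    rw [this]
    rw [mul_add, mul_one] at h
    linarith

lemma Cu_nonneg (r : ℝ≥0) : 0 ≤ Cu r := by
  have := Cr_nonneg r
  unfold Cu; positivity

lemma intRisk_bd {r : ℝ≥0} (hr : 0 < r) {η : ℝ} (h0 : 0 < η) (h1 : η < 1 / 2)
    (hE : η = (1 - η) * Real.exp (-lamE η ^ 2 / 2)) (hL : 8 ≤ lamE η)
    (hLf : 2 ≤ √(vw r) * lamE η) {π : Measure ℝ} (hπ : π ∈ priorClass η) :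
    intRisk1 r π (pTCL r η) ≤ η * (lamE η ^ 2 / (2 * (1 + r)) +
      (Cu r + (2 + 8 * (Cr r + 1))) * (lamE η * √(lamE η))) := by
  obtain ⟨hp, hm⟩ := hπ
  have hC := Cr_nonneg r
  have hCu := Cu_nonneg r
  have hq1 : 1 ≤ √(lamE η) := by rw [Real.one_le_sqrt]; linarith
  have hWL : lamE η ≤ lamE η * √(lamE η) := by nlinarith
  set W := lamE η * √(lamE η) with hW
  set B1 := lamE η ^ 2 / (2 * (1 + (r:ℝ))) + Cu r * W with hB1
  have hB1n : 0 ≤ B1 := by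
    have : 0 ≤ W := by linarith
    positivity
  set B0 := η * (2 + 8 * (Cr r + 1)) * W with hB0
  have hB0n : 0 ≤ B0 := by
    have : 0 ≤ W := by linarith
    positivity
  have hz : risk1 r 0 (pTCL r η) ≤ B0 := by
    have h := risk_at_zero hr h0 (by linarith) hE (by linarith)
    have he : Real.exp (-lamE η ^ 2 / 2) ≤ 2 * η := by
      nlinarith [Real.exp_pos (-lamE η ^ 2 / 2)]
    calc _ ≤ _ := h
      _ ≤ 2 * η * (1 + (Cr r + 1) * (2 * (lamE η + 1))) := by
        have : 0 ≤ lamE η + 1 := by linarith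
        gcongr
      _ ≤ B0 := by
        rw [hB0, mul_comm 2 η, mul_assoc, mul_assoc]
        have : 2 * (1 + (Cr r + 1) * (2 * (lamE η + 1))) ≤ (2 + 8 * (Cr r + 1)) * W := by
          nlinarith
        gcongr
  have hms : MeasurableSet {θ : ℝ | θ ≠ 0} := (measurableSet_singleton (0:ℝ)).compl
  have hint : Integrable (fun θ => B0 + Set.indicator {θ : ℝ | θ ≠ 0} (fun _ => B1) θ) π :=
    (integrable_const B0).add ((integrable_const B1).indicator hms)
  have := integral_le_max_zero (f := fun θ => risk1 r θ (pTCL r η)) hint (ae_of_all _ fun θ => ?_)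
  · rw [integral_add (integrable_const B0) ((integrable_const B1).indicator hms),
      integral_indicator_const _ hms] at this
    simp only [integral_const, probReal_univ, smul_eq_mul] at this
    have hreal : π.real {θ : ℝ | θ ≠ 0} ≤ η := ENNReal.toReal_le_of_le_ofReal h0.le hm
    refine this.trans (max_le ?_ ?_)
    · have : 0 ≤ W := by linarith
      positivity
    · calc _ ≤ B0 + η * B1 := by rw [one_mul]; gcongr
        _ = _ := by rw [hB0, hB1]; ring
  · by_cases hθ : θ = 0
    · subst hθ
      simpa using hz
    · simp only
      rw [Set.indicator_of_mem (show θ ∈ {θ : ℝ | θ ≠ 0} from hθ)]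
      have := risk_uniform hr h0 (by linarith) hE hL hLf θ
      linarith

lemma lamE_tendsto : Tendsto lamE (nhdsWithin 0 (Set.Ioi 0)) atTop := by
  unfold lamE
  refine Real.tendsto_sqrt_atTop.comp (Tendsto.const_mul_atTop two_pos ?_)
  refine Real.tendsto_log_atTop.comp ?_
  refine Tendsto.atTop_mul_pos (C := 1) one_pos tendsto_inv_nhdsGT_zero ?_
  have : Tendsto (fun η : ℝ => 1 - η) (nhds 0) (nhds (1 - 0)) := tendsto_const_nhds.sub tendsto_id
  simpa using this.mono_left nhdsWithin_le_nhds

lemma lamE_exp {η : ℝ} (h0 : 0 < η) (h1 : η < 1 / 2) :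
    η = (1 - η) * Real.exp (-lamE η ^ 2 / 2) := by
  have h2 : 0 < 1 - η := by linarith
  have h3 : 1 ≤ η⁻¹ * (1 - η) := by
    rw [inv_mul_eq_div, le_div_iff₀ h0]; linarith
  have := Real.log_nonneg h3
  unfold lamE
  rw [neg_div, Real.sq_sqrt (by linarith), mul_div_cancel_left₀ _ two_ne_zero, Real.exp_neg,
    Real.exp_log (by linarith)]
  field_simp

/-- upper bound for the cluster-prior threshold estimator:
`limsup_{η→0⁺} [sup_{π ∈ 𝔪(η)} B(π, p̂_{T,CL})] / ((2r)⁻¹ η λ_f(η)²) ≤ 1`. -/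
theorem cluster_threshold_estimator_upper_bound (r : ℝ≥0) (hr : 0 < r) :
    Filter.limsup (fun η : ℝ =>
        (⨆ π : priorClass η, intRisk1 r π.1 (pTCL r η)) /
          ((2 * (r : ℝ))⁻¹ * η * lamF (r : ℝ) η ^ 2))
      (nhdsWithin 0 (Set.Ioi 0)) ≤ 1 := by
  have hr' : (0 : ℝ) < r := hr
  have hvw0 : 0 < vw r := by unfold vw; positivity
  have hw0 : 0 < √(vw r) := Real.sqrt_pos.2 hvw0
  set D := Cu r + (2 + 8 * (Cr r + 1)) with hD
  have hD0 : 0 ≤ D := by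
    have := Cu_nonneg r
    have := Cr_nonneg r
    positivity
  have hmain : ∀ ε : ℝ, 0 < ε → ∀ᶠ η in nhdsWithin (0:ℝ) (Set.Ioi 0),
      (⨆ π : priorClass η, intRisk1 r π.1 (pTCL r η)) /
          ((2 * (r : ℝ))⁻¹ * η * lamF (r : ℝ) η ^ 2) ≤ 1 + ε := by
    intro ε hε
    have hη1 : ∀ᶠ η in nhdsWithin (0:ℝ) (Set.Ioi 0), η < 1 / 2 :=
      nhdsWithin_le_nhds (eventually_lt_nhds (by norm_num))
    have hL2 := (Real.tendsto_sqrt_atTop.comp lamE_tendsto).eventually_ge_atTop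
      (2 * (1 + r) * D / ε)
    filter_upwards [self_mem_nhdsWithin, hη1, lamE_tendsto.eventually_ge_atTop 8,
      lamE_tendsto.eventually_ge_atTop (2 / √(vw r)), hL2] with η h0 h1 hL hLf hLε
    have h0 : 0 < η := h0
    have hE := lamE_exp h0 h1
    have hLf' : 2 ≤ √(vw r) * lamE η := by
      rw [div_le_iff₀ hw0] at hLf; linarith
    have hLpos : 0 < lamE η := by linarith
    simp only [Function.comp] at hLε
    set q := √(lamE η) with hq
    have hq2 : q ^ 2 = lamE η := Real.sq_sqrt hLpos.le
    have hq0 : 0 < q := Real.sqrt_pos.2 hLpos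
    have hden : (2 * (r : ℝ))⁻¹ * η * lamF (r : ℝ) η ^ 2 = η * (lamE η ^ 2 / (2 * (1 + r))) := by
      unfold lamF
      rw [mul_pow, Real.sq_sqrt hvw0.le]
      unfold vw
      field_simp
    rw [hden, div_le_iff₀ (by positivity)]
    have hbd : η * (lamE η ^ 2 / (2 * (1 + r)) + D * (lamE η * q))
        ≤ (1 + ε) * (η * (lamE η ^ 2 / (2 * (1 + r)))) := by
      have key : D * (lamE η * q) ≤ ε * (lamE η ^ 2 / (2 * (1 + r))) := by
        rw [div_le_iff₀ hε] at hLε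
        rw [← mul_div_assoc, le_div_iff₀ (by positivity)]
        have := mul_le_mul_of_nonneg_right hLε (show 0 ≤ lamE η * q by positivity)
        calc _ = 2 * (1 + r) * D * (lamE η * q) := by ring
          _ ≤ q * ε * (lamE η * q) := this
          _ = ε * (lamE η * q ^ 2) := by ring
          _ = _ := by rw [hq2]; ring
      have := mul_le_mul_of_nonneg_left key h0.le
      linarith
    refine Real.iSup_le (fun π => (intRisk_bd hr h0 h1 hE hL hLf' π.2).trans hbd) (by positivity)
  rw [Filter.limsup_eq]
  refine le_of_forall_pos_le_add fun ε hε => ?_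
  by_cases hb : BddBelow {a : ℝ | ∀ᶠ η in nhdsWithin (0:ℝ) (Set.Ioi 0),
      (⨆ π : priorClass η, intRisk1 r π.1 (pTCL r η)) /
          ((2 * (r : ℝ))⁻¹ * η * lamF (r : ℝ) η ^ 2) ≤ a}
  · exact csInf_le hb (hmain ε hε)
  · rw [Real.sInf_of_not_bddBelow hb]; linarith
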